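/- Let A ⊆ ℝ² be measurable, let n ∈ ℕ, and let (f_r)_{r ∈ {0,1}^n} be functions each equal to either 𝟙_A or 𝟙_{ℝ²}. Then the joint upper Banach density satisfies δ̄((f_r)_r) ≥ c_n · δ̄(A)^{2^n} for a constant c_n > 0 depending only on n. -/

import Mathlib

open MeasureTheory

/-- The axis-parallel square `z + [0,R]²`. -/
def cube (z : EuclideanSpace ℝ (Fin 2)) (R : ℝ) : Set (EuclideanSpace ℝ (Fin 2)) :=
  {x | ∀ i, x i ∈ Set.Icc (z i) (z i + R)}

/-- Upper Banach density of a planar set. -/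
noncomputable def banachDensity (A : Set (EuclideanSpace ℝ (Fin 2))) : ℝ :=
  Filter.limsup
    (fun R : ℝ => ⨆ z : EuclideanSpace ℝ (Fin 2),
      (volume (A ∩ cube z R)).toReal / R ^ 2) Filter.atTop

/-- The normalized hypercubic average appearing in the joint upper Banach density. -/
noncomputable def jointAvg (n : ℕ)
    (f : (Fin n → Bool) → EuclideanSpace ℝ (Fin 2) → ℝ)
    (z : EuclideanSpace ℝ (Fin 2)) (R r : ℝ) : ℝ :=
  (2 * r) ^ (-(2 * (n : ℝ))) * R ^ (-2 : ℝ) *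
    ∫ x in cube z R, ∫ v in {v : Fin n → EuclideanSpace ℝ (Fin 2) |
        ∀ i j, |v i j| ≤ r},
      ∏ s : Fin n → Bool, f s (x + ∑ i, if s i then v i else 0)

/-- The joint upper Banach density of a family of functions. -/
noncomputable def jointDensity (n : ℕ)
    (f : (Fin n → Bool) → EuclideanSpace ℝ (Fin 2) → ℝ) : ℝ :=
  ⨆ (M : ℝ) (_ : 1 ≤ M),
    Filter.limsup
      (fun R : ℝ => ⨆ z : EuclideanSpace ℝ (Fin 2),
        ⨅ r : {r : ℝ // M ≤ r ∧ r ≤ R / 2 ^ n}, jointAvg n f z R r)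
      Filter.atTop


open ENNReal

/-- The Euclidean plane. -/
abbrev Plane := EuclideanSpace ℝ (Fin 2)

/-- The Cauchy–Schwarz inequality against the constant function `1`. -/
lemma sq_lintegral_le {α : Type*} [MeasurableSpace α] (μ : Measure α) {U : α → ℝ≥0∞}
    (hU : Measurable U) : (∫⁻ a, U a ∂μ) ^ 2 ≤ μ Set.univ * ∫⁻ a, U a ^ 2 ∂μ := by
  have h := ENNReal.lintegral_mul_le_Lp_mul_Lq μ Real.HolderConjugate.two_two
    (f := fun _ => 1) aemeasurable_const hU.aemeasurable
  simp only [Pi.mul_apply, one_mul, lintegral_const, ENNReal.rpow_two] at h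
  have h2 := pow_le_pow_left' h 2
  have hsqrt (a : ℝ≥0∞) : (a ^ (1 / 2 : ℝ)) ^ 2 = a := by
    rw [← ENNReal.rpow_natCast, ← ENNReal.rpow_mul]
    simp
  simpa only [mul_pow, hsqrt, one_pow, one_mul] using h2

lemma measurableSet_cube_prod (r : ℝ) :
    MeasurableSet {p : Plane × Plane | p.1 ∈ cube p.2 r} := by
  have h (i : Fin 2) :
      MeasurableSet {p : Plane × Plane | p.2 i ≤ p.1 i ∧ p.1 i ≤ p.2 i + r} :=
    MeasurableSet.inter (s₁ := {p : Plane × Plane | p.2 i ≤ p.1 i})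
      (s₂ := {p : Plane × Plane | p.1 i ≤ p.2 i + r})
      (measurableSet_le (by fun_prop) (by fun_prop))
      (measurableSet_le (by fun_prop) (by fun_prop))
  convert MeasurableSet.iInter h using 1
  ext p
  simp [cube]

lemma measurableSet_cube (z : Plane) (R : ℝ) : MeasurableSet (cube z R) :=
  (measurableSet_cube_prod R).preimage (measurable_id.prodMk measurable_const)

lemma volume_cube (z : Plane) {R : ℝ} (hR : 0 ≤ R) :
    volume (cube z R) = ENNReal.ofReal (R ^ 2) := by
  have : cube z R = (WithLp.ofLp : Plane → Fin 2 → ℝ) ⁻¹'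
      Set.Icc (fun i => z i) (fun i => z i + R) := by
    ext x
    simp [cube, Pi.le_def, forall_and]
  rw [this, (PiLp.volume_preserving_ofLp (Fin 2)).measure_preimage
    measurableSet_Icc.nullMeasurableSet, Real.volume_Icc_pi]
  simp [ENNReal.ofReal_pow hR]

lemma measurableSet_box (r : ℝ) : MeasurableSet {h : Plane | ∀ j, |h j| ≤ r} := by
  have h (j : Fin 2) : MeasurableSet {h : Plane | |h j| ≤ r} :=
    measurableSet_le (by fun_prop) (by fun_prop)
  convert MeasurableSet.iInter h using 1
  ext p
  simp

lemma volume_box {r : ℝ} (hr : 0 ≤ r) :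
    volume {h : Plane | ∀ j, |h j| ≤ r} = ENNReal.ofReal ((2 * r) ^ 2) := by
  rw [← volume_cube (WithLp.toLp 2 fun _ => -r) (by positivity)]
  congr 1
  ext h
  simp only [cube, Set.mem_Icc, Set.mem_ofPred_eq, abs_le]
  refine forall_congr' fun i => and_congr_right fun _ => ?_
  rw [show -r + 2 * r = r by ring]

/-- The plane vector with both coordinates equal to `r`. -/
noncomputable def diag (r : ℝ) : Plane := WithLp.toLp 2 fun _ => r

@[simp] lemma diag_apply (r : ℝ) (i : Fin 2) : diag r i = r := rfl

lemma mem_cube_comm {x y : Plane} {r : ℝ} : x ∈ cube y r ↔ y ∈ cube (x - diag r) r := by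
  simp only [cube, Set.mem_Icc, Set.mem_ofPred_eq, PiLp.sub_apply, diag_apply]
  refine forall_congr' fun i => ?_
  constructor <;> rintro ⟨h1, h2⟩ <;> constructor <;> linarith

/-- The autocorrelation of `u` over small shifts is at least a multiple of its squared mass. -/
lemma sq_lintegral_le_correlation {u : Plane → ℝ≥0∞} (hu : Measurable u) {z : Plane} {R r : ℝ}
    (hr : 0 < r) (hrR : r ≤ R) (hsupp : ∀ x, x ∉ cube z R → u x = 0) :
    ENNReal.ofReal (r ^ 2) * (∫⁻ x, u x) ^ 2 ≤
      ENNReal.ofReal (4 * R ^ 2) *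
        ∫⁻ h in {h : Plane | ∀ j, |h j| ≤ r}, ∫⁻ x, u x * u (x + h) := by
  set K : Plane → Plane → ℝ≥0∞ := fun x y =>
    {p : Plane × Plane | p.1 ∈ cube p.2 r}.indicator 1 (x, y) with hK
  have hKm : Measurable fun p : Plane × Plane => K p.1 p.2 :=
    measurable_one.indicator (measurableSet_cube_prod r)
  have hKm' {β : Type} [MeasurableSpace β] {f g : β → Plane} (hf : Measurable f)
      (hg : Measurable g) : Measurable fun b => K (f b) (g b) := hKm.comp (hf.prodMk hg)
  have hKind (x : Plane) : K x = (cube (x - diag r) r).indicator 1 := by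
    ext y
    by_cases h : x ∈ cube y r
    · rw [Set.indicator_of_mem (mem_cube_comm.1 h)]
      exact Set.indicator_of_mem (s := {p : Plane × Plane | p.1 ∈ cube p.2 r}) h 1
    · rw [Set.indicator_of_notMem (mt mem_cube_comm.2 h)]
      exact Set.indicator_of_notMem (s := {p : Plane × Plane | p.1 ∈ cube p.2 r}) h 1
  have hKint (x : Plane) : ∫⁻ y, K x y = ENNReal.ofReal (r ^ 2) := by
    rw [hKind, lintegral_indicator_one (measurableSet_cube _ _), volume_cube _ hr.le]
  have hKK (x x' : Plane) : ∫⁻ y, K x y * K x' y ≤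
      ENNReal.ofReal (r ^ 2) * {h : Plane | ∀ j, |h j| ≤ r}.indicator 1 (x' - x) := by
    by_cases h : ∀ j, |(x' - x) j| ≤ r
    · rw [Set.indicator_of_mem (by exact h), Pi.one_apply, mul_one, ← hKint x]
      refine lintegral_mono fun y => mul_le_of_le_one_right' ?_
      exact Set.indicator_le_self' (by simp) _ |>.trans (by simp)
    · refine (le_of_eq ?_).trans zero_le
      refine (lintegral_congr fun y => ?_).trans lintegral_zero
      by_contra hne
      obtain ⟨h1, h2⟩ := mul_ne_zero_iff.1 hne
      have h1 := Set.mem_of_indicator_ne_zero h1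
      have h2 := Set.mem_of_indicator_ne_zero h2
      refine h fun j => ?_
      have h1 := h1 j
      have h2 := h2 j
      simp only [Set.mem_Icc] at h1 h2
      rw [PiLp.sub_apply, abs_le]
      constructor <;> linarith
  set U : Plane → ℝ≥0∞ := fun y => ∫⁻ x, K x y * u x with hU
  have hUm : Measurable U := by
    apply Measurable.lintegral_prod_right'
      (f := fun p : Plane × Plane => K p.2 p.1 * u p.2)
    exact (hKm' measurable_snd measurable_fst).mul (hu.comp measurable_snd)
  have hUint : ∫⁻ y, U y = ENNReal.ofReal (r ^ 2) * ∫⁻ x, u x := by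
    rw [hU, lintegral_lintegral_swap, ← lintegral_const_mul _ hu]
    · refine lintegral_congr fun x => ?_
      rw [lintegral_mul_const (f := K x) _ (hKm' measurable_const measurable_id), hKint]
    · exact ((hKm' measurable_snd measurable_fst).mul (hu.comp measurable_snd)).aemeasurable
  have hUsupp (y : Plane) (hy : y ∉ cube (z - diag r) (R + r)) : U y = 0 := by
    refine (lintegral_congr fun x => ?_).trans lintegral_zero
    by_contra hne
    obtain ⟨h1, h2⟩ := mul_ne_zero_iff.1 hne
    have h1 := Set.mem_of_indicator_ne_zero h1
    have h2 : x ∈ cube z R := by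
      by_contra h
      exact h2 (hsupp x h)
    refine hy fun i => ?_
    have h1 := h1 i
    have h2 := h2 i
    simp only [Set.mem_Icc, PiLp.sub_apply, diag_apply] at h1 h2 ⊢
    constructor <;> linarith
  have hCS : (∫⁻ y, U y) ^ 2 ≤ ENNReal.ofReal (4 * R ^ 2) * ∫⁻ y, U y ^ 2 := by
    have h := sq_lintegral_le (volume.restrict (cube (z - diag r) (R + r))) hUm
    rw [Measure.restrict_apply_univ, volume_cube _ (by linarith),
      setLIntegral_eq_of_support_subset fun y hy => by_contra fun hn => hy (hUsupp y hn)] at h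
    refine h.trans (mul_le_mul' (ENNReal.ofReal_le_ofReal (by nlinarith)) ?_)
    exact setLIntegral_le_lintegral _ _
  have hUsq : ∫⁻ y, U y ^ 2 ≤ ENNReal.ofReal (r ^ 2) *
      ∫⁻ h in {h : Plane | ∀ j, |h j| ≤ r}, ∫⁻ x, u x * u (x + h) := by
    have hm {β : Type} [MeasurableSpace β] {f g : β → Plane} (hf : Measurable f)
        (hg : Measurable g) : Measurable fun b => K (f b) (g b) * u (f b) :=
      (hKm' hf hg).mul (hu.comp hf)
    calc ∫⁻ y, U y ^ 2 = ∫⁻ y, ∫⁻ x, ∫⁻ x', K x y * u x * (K x' y * u x') := by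
          refine lintegral_congr fun y => ?_
          have hy : Measurable fun x => K x y * u x := hm measurable_id measurable_const
          simp_rw [lintegral_const_mul _ hy]
          rw [lintegral_mul_const _ hy, sq]
      _ = ∫⁻ x, ∫⁻ x', ∫⁻ y, K x y * u x * (K x' y * u x') := by
          rw [lintegral_lintegral_swap]
          · refine lintegral_congr fun x => ?_
            rw [lintegral_lintegral_swap]
            exact ((hm measurable_const measurable_fst).mul
              (hm measurable_snd measurable_fst)).aemeasurable
          · refine (Measurable.lintegral_prod_right' (f := fun p : (Plane × Plane) × Plane =>
              K p.1.2 p.1.1 * u p.1.2 * (K p.2 p.1.1 * u p.2)) ?_).aemeasurable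
            exact (hm (by fun_prop) (by fun_prop)).mul (hm (by fun_prop) (by fun_prop))
      _ ≤ ∫⁻ x, ∫⁻ x', ENNReal.ofReal (r ^ 2) *
            ({h : Plane | ∀ j, |h j| ≤ r}.indicator 1 (x' - x) * (u x * u x')) := by
          refine lintegral_mono fun x => lintegral_mono fun x' => ?_
          calc _ = ∫⁻ y, K x y * K x' y * (u x * u x') := lintegral_congr fun y => by ring
            _ = (∫⁻ y, K x y * K x' y) * (u x * u x') :=
              lintegral_mul_const _ ((hKm' measurable_const measurable_id).mul
                (hKm' measurable_const measurable_id))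
            _ ≤ _ := by
              rw [← mul_assoc (ENNReal.ofReal _)]
              exact mul_le_mul_left (hKK x x') _
      _ = ∫⁻ x, ∫⁻ h, ENNReal.ofReal (r ^ 2) *
            ({h : Plane | ∀ j, |h j| ≤ r}.indicator 1 h * (u x * u (x + h))) := by
          refine lintegral_congr fun x => ?_
          rw [← lintegral_add_left_eq_self _ x]
          simp
      _ = ∫⁻ h, ∫⁻ x, ENNReal.ofReal (r ^ 2) *
            ({h : Plane | ∀ j, |h j| ≤ r}.indicator 1 h * (u x * u (x + h))) := by
          refine lintegral_lintegral_swap (Measurable.aemeasurable ?_)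
          refine Measurable.const_mul (Measurable.mul ?_ ?_) _
          · exact (measurable_one.indicator (measurableSet_box r)).comp measurable_snd
          · exact (hu.comp measurable_fst).mul (hu.comp (measurable_fst.add measurable_snd))
      _ = _ := by
          rw [← lintegral_indicator (measurableSet_box r), ← lintegral_const_mul']
          · refine lintegral_congr fun h => ?_
            rw [lintegral_const_mul' _ _ ENNReal.ofReal_ne_top]
            by_cases hh : h ∈ {h : Plane | ∀ j, |h j| ≤ r}
            · simp only [Set.indicator_of_mem hh, Pi.one_apply, one_mul]
            · simp only [Set.indicator_of_notMem hh, zero_mul, lintegral_zero]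
          · exact ENNReal.ofReal_ne_top
  have hr0 : ENNReal.ofReal (r ^ 2) ≠ 0 := by simpa using hr.ne'
  rw [hUint] at hCS
  have := hCS.trans (mul_le_mul_right hUsq _)
  rw [← ENNReal.mul_le_mul_iff_right hr0 ENNReal.ofReal_ne_top]
  calc _ = (ENNReal.ofReal (r ^ 2) * ∫⁻ x, u x) ^ 2 := by ring
    _ ≤ _ := this
    _ = _ := by ring

/-- The product of `g` over the vertices of the parallelepiped based at `x` with edges `v`. -/
noncomputable def vertexProd (n : ℕ) (g : Plane → ℝ≥0∞) (x : Plane) (v : Fin n → Plane) : ℝ≥0∞ :=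
  ∏ s : Fin n → Bool, g (x + ∑ i, if s i then v i else 0)

/-- The integral of `vertexProd` over all base points and all edges in `[-r,r]²`. -/
noncomputable def parallelepipedMass (n : ℕ) (g : Plane → ℝ≥0∞) (r : ℝ) : ℝ≥0∞ :=
  ∫⁻ v in {v : Fin n → Plane | ∀ i j, |v i j| ≤ r}, ∫⁻ x, vertexProd n g x v

lemma measurable_vertex {n : ℕ} (s : Fin n → Bool) :
    Measurable fun p : Plane × (Fin n → Plane) => p.1 + ∑ i, if s i then p.2 i else 0 := by
  refine measurable_fst.add (Finset.measurable_sum _ fun i _ => ?_)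
  by_cases h : s i
  · simp only [h, if_true]
    exact (measurable_pi_apply i).comp measurable_snd
  · simp only [h]
    exact measurable_const

lemma measurable_vertexProd (n : ℕ) {g : Plane → ℝ≥0∞} (hg : Measurable g) :
    Measurable fun p : Plane × (Fin n → Plane) => vertexProd n g p.1 p.2 :=
  Finset.measurable_prod _ fun s _ => hg.comp (measurable_vertex s)

lemma vertexProd_cons (n : ℕ) (g : Plane → ℝ≥0∞) (x h : Plane) (v : Fin n → Plane) :
    vertexProd (n + 1) g x (Fin.cons h v) = vertexProd n g x v * vertexProd n g (x + h) v := by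
  simp only [vertexProd]
  rw [← (Fin.consEquiv fun _ => Bool).prod_comp, Fintype.prod_prod_type, Fintype.prod_bool,
    mul_comm]
  simp [Fin.consEquiv, Fin.sum_univ_succ, add_assoc]

lemma setOf_edges_eq_pi (n : ℕ) (r : ℝ) :
    {v : Fin n → Plane | ∀ i j, |v i j| ≤ r} =
      Set.univ.pi fun _ => {h : Plane | ∀ j, |h j| ≤ r} := by
  ext v
  simp

lemma measurableSet_edges (n : ℕ) (r : ℝ) :
    MeasurableSet {v : Fin n → Plane | ∀ i j, |v i j| ≤ r} := by
  rw [setOf_edges_eq_pi]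
  exact MeasurableSet.univ_pi fun _ => measurableSet_box r

lemma volume_edges (n : ℕ) {r : ℝ} (hr : 0 ≤ r) :
    volume {v : Fin n → Plane | ∀ i j, |v i j| ≤ r} = ENNReal.ofReal (((2 * r) ^ 2) ^ n) := by
  rw [setOf_edges_eq_pi, volume_pi_pi]
  simp only [volume_box hr, Finset.prod_const, Finset.card_univ, Fintype.card_fin,
    ENNReal.ofReal_pow (sq_nonneg (2 * r))]

lemma parallelepipedMass_zero (g : Plane → ℝ≥0∞) (r : ℝ) :
    parallelepipedMass 0 g r = ∫⁻ x, g x := by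
  simp [parallelepipedMass, vertexProd, volume_pi]

lemma parallelepipedMass_succ (n : ℕ) {g : Plane → ℝ≥0∞} (hg : Measurable g) (r : ℝ) :
    parallelepipedMass (n + 1) g r =
      ∫⁻ v in {v : Fin n → Plane | ∀ i j, |v i j| ≤ r}, ∫⁻ h in {h : Plane | ∀ j, |h j| ≤ r},
        ∫⁻ x, vertexProd n g x v * vertexProd n g (x + h) v := by
  have he := (volume_preserving_piFinSuccAbove (fun _ : Fin (n + 1) => Plane) 0).symm
  have hm : Measurable fun v : Fin (n + 1) → Plane => ∫⁻ x, vertexProd (n + 1) g x v :=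
    (measurable_vertexProd (n + 1) hg).lintegral_prod_left'
  rw [parallelepipedMass, ← he.setLIntegral_comp_preimage (measurableSet_edges _ _) hm]
  have hpre : (MeasurableEquiv.piFinSuccAbove (fun _ : Fin (n + 1) => Plane) 0).symm ⁻¹'
      {v : Fin (n + 1) → Plane | ∀ i j, |v i j| ≤ r} =
      {h : Plane | ∀ j, |h j| ≤ r} ×ˢ {v : Fin n → Plane | ∀ i j, |v i j| ≤ r} := by
    ext p
    simp [Fin.forall_fin_succ, Fin.insertNthEquiv]
  rw [hpre, Measure.volume_eq_prod, ← Measure.prod_restrict, lintegral_prod_symm]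
  · refine lintegral_congr fun v => lintegral_congr fun h => lintegral_congr fun x => ?_
    rw [← vertexProd_cons]
    simp [Fin.insertNthEquiv]
  · exact (hm.comp he.measurable).aemeasurable

/-- One Cauchy–Schwarz step: the mass in dimension `n` controls the mass in dimension `n + 1`. -/
lemma sq_parallelepipedMass_le (n : ℕ) {g : Plane → ℝ≥0∞} (hg : Measurable g) {z : Plane}
    {R r : ℝ} (hr : 0 < r) (hrR : r ≤ R) (hsupp : ∀ x, x ∉ cube z R → g x = 0) :
    ENNReal.ofReal (r ^ 2) * parallelepipedMass n g r ^ 2 ≤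
      ENNReal.ofReal (((2 * r) ^ 2) ^ n) *
        (ENNReal.ofReal (4 * R ^ 2) * parallelepipedMass (n + 1) g r) := by
  have hm : Measurable fun v : Fin n → Plane => ∫⁻ x, vertexProd n g x v :=
    (measurable_vertexProd n hg).lintegral_prod_left'
  have hCS := sq_lintegral_le
    (volume.restrict {v : Fin n → Plane | ∀ i j, |v i j| ≤ r}) hm
  rw [Measure.restrict_apply_univ, volume_edges n hr.le] at hCS
  refine (mul_le_mul_right hCS _).trans ?_
  rw [mul_left_comm]
  refine mul_le_mul_right ?_ _
  rw [parallelepipedMass_succ n hg, ← lintegral_const_mul' _ _ ENNReal.ofReal_ne_top,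
    ← lintegral_const_mul' _ _ ENNReal.ofReal_ne_top]
  refine lintegral_mono fun v => ?_
  refine sq_lintegral_le_correlation (u := fun x => vertexProd n g x v) (z := z)
    ((measurable_vertexProd n hg).comp (measurable_id.prodMk measurable_const)) hr hrR
    fun x hx => ?_
  refine Finset.prod_eq_zero (Finset.mem_univ fun _ => false) ?_
  simpa using hsupp x hx

lemma parallelepipedMass_le (n : ℕ) {g : Plane → ℝ≥0∞} {z : Plane} {R r : ℝ} (hr : 0 ≤ r)
    (hR : 0 ≤ R) (hsupp : ∀ x, x ∉ cube z R → g x = 0) (hg1 : ∀ x, g x ≤ 1) :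
    parallelepipedMass n g r ≤ ENNReal.ofReal (((2 * r) ^ 2) ^ n * R ^ 2) := by
  have h (v : Fin n → Plane) : ∫⁻ x, vertexProd n g x v ≤ ENNReal.ofReal (R ^ 2) := by
    rw [← volume_cube z hR, ← lintegral_indicator_one (measurableSet_cube z R)]
    refine lintegral_mono fun x => ?_
    by_cases hx : x ∈ cube z R
    · rw [Set.indicator_of_mem hx]
      exact Finset.prod_le_one' fun s _ => hg1 _
    · refine (Finset.prod_eq_zero (Finset.mem_univ fun _ => false) ?_).trans_le zero_le
      simpa using hsupp x hx
  refine (lintegral_mono h).trans ?_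
  rw [lintegral_const, Measure.restrict_apply_univ, volume_edges n hr, mul_comm,
    ENNReal.ofReal_mul (by positivity)]

/-- Lower bound for the normalised mass, by iterating the Cauchy–Schwarz step. -/
lemma pow_le_parallelepipedMass (n : ℕ) {g : Plane → ℝ≥0∞} (hg : Measurable g) {z : Plane}
    {R r : ℝ} (hr : 0 < r) (hrR : r ≤ R) (hsupp : ∀ x, x ∉ cube z R → g x = 0)
    (hg1 : ∀ x, g x ≤ 1) :
    ((∫⁻ x, g x).toReal / R ^ 2 / 16) ^ 2 ^ n ≤
      (parallelepipedMass n g r).toReal / (((2 * r) ^ 2) ^ n * R ^ 2) / 16 := by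
  have hR : 0 < R := hr.trans_le hrR
  have hfin (m : ℕ) : parallelepipedMass m g r ≠ ⊤ :=
    ((parallelepipedMass_le m hr.le hR.le hsupp hg1).trans_lt ENNReal.ofReal_lt_top).ne
  induction n with
  | zero => simp [parallelepipedMass_zero]
  | succ n ih =>
    have h := ENNReal.toReal_mono (by finiteness [hfin (n + 1)])
      (sq_parallelepipedMass_le n hg hr hrR hsupp)
    simp only [ENNReal.toReal_mul, ENNReal.toReal_pow] at h
    rw [ENNReal.toReal_ofReal (by positivity), ENNReal.toReal_ofReal (by positivity),
      ENNReal.toReal_ofReal (by positivity)] at h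
    rw [pow_succ 2 n, pow_mul]
    refine (pow_le_pow_left₀ (by positivity) ih 2).trans ?_
    set F := (parallelepipedMass n g r).toReal
    set G := (parallelepipedMass (n + 1) g r).toReal
    set T := ((2 * r) ^ 2) ^ n with hT
    have hTpos : 0 < T := by positivity
    rw [pow_succ _ n, ← hT, div_div, div_div, div_pow, div_le_div_iff₀ (by positivity)
      (by positivity)]
    nlinarith [mul_le_mul_of_nonneg_left h (by positivity : 0 ≤ 64 * T * R ^ 2)]

/-- The unnormalised joint average is nonnegative, at most the volume of the domain of
integration, and at least the parallelepiped mass of `A ∩ cube z R`. -/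
lemma integral_vertices_bounds (n : ℕ) {A : Set Plane} (hA : MeasurableSet A)
    {f : (Fin n → Bool) → Plane → ℝ} (hf : ∀ s, f s = A.indicator 1 ∨ f s = fun _ => 1)
    (z : Plane) {R r : ℝ} (hr : 0 ≤ r) (hR : 0 ≤ R) :
    let I := ∫ x in cube z R, ∫ v in {v : Fin n → Plane | ∀ i j, |v i j| ≤ r},
      ∏ s : Fin n → Bool, f s (x + ∑ i, if s i then v i else 0)
    0 ≤ I ∧ I ≤ ((2 * r) ^ 2) ^ n * R ^ 2 ∧
      (parallelepipedMass n ((A ∩ cube z R).indicator 1) r).toReal ≤ I := by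
  intro I
  have hfm (s) : Measurable (f s) := by
    rcases hf s with h | h <;> rw [h]
    · exact measurable_one.indicator hA
    · exact measurable_const
  have hf0 (s x) : 0 ≤ f s x := by
    rcases hf s with h | h <;> rw [h]
    · exact Set.indicator_nonneg (fun _ _ => zero_le_one) x
    · exact zero_le_one
  have hf1 (s x) : f s x ≤ 1 := by
    rcases hf s with h | h <;> rw [h]
    exact Set.indicator_le' (fun _ _ => le_rfl) (fun _ _ => zero_le_one) x
  set φ : Plane × (Fin n → Plane) → ℝ :=
    fun p => ∏ s : Fin n → Bool, f s (p.1 + ∑ i, if s i then p.2 i else 0) with hφ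
  have hφm : Measurable φ :=
    Finset.measurable_prod _ fun s _ => (hfm s).comp (measurable_vertex s)
  have hφ0 (p) : 0 ≤ φ p := Finset.prod_nonneg fun s _ => hf0 s _
  have hφ1 (p) : φ p ≤ 1 := Finset.prod_le_one (fun s _ => hf0 s _) fun s _ => hf1 s _
  set μ : Measure Plane := volume.restrict (cube z R) with hμ
  set ν : Measure (Fin n → Plane) :=
    volume.restrict {v : Fin n → Plane | ∀ i j, |v i j| ≤ r} with hν
  have hμu : μ Set.univ = ENNReal.ofReal (R ^ 2) := by
    rw [hμ, Measure.restrict_apply_univ, volume_cube z hR]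
  have hνu : ν Set.univ = ENNReal.ofReal (((2 * r) ^ 2) ^ n) := by
    rw [hν, Measure.restrict_apply_univ, volume_edges n hr]
  have : IsFiniteMeasure μ := ⟨hμu ▸ ENNReal.ofReal_lt_top⟩
  have : IsFiniteMeasure ν := ⟨hνu ▸ ENNReal.ofReal_lt_top⟩
  have hint : Integrable φ (μ.prod ν) :=
    Integrable.of_bound hφm.aestronglyMeasurable 1
      (ae_of_all _ fun p => by rw [Real.norm_of_nonneg (hφ0 p)]; exact hφ1 p)
  have hI : I = ∫ p, φ p ∂(μ.prod ν) := (integral_prod φ hint).symm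
  refine ⟨hI ▸ integral_nonneg hφ0, ?_, ?_⟩
  · rw [hI]
    refine (integral_mono hint (integrable_const 1) hφ1).trans (le_of_eq ?_)
    rw [integral_const, smul_eq_mul, mul_one, Measure.real, ← Set.univ_prod_univ,
      Measure.prod_prod, hμu, hνu, ENNReal.toReal_mul, ENNReal.toReal_ofReal (by positivity),
      ENNReal.toReal_ofReal (by positivity), mul_comm]
  · have hlint := integral_eq_lintegral_of_nonneg_ae (ae_of_all _ hφ0) hint.aestronglyMeasurable
    have hfin : ∫⁻ p, ENNReal.ofReal (φ p) ∂(μ.prod ν) ≠ ⊤ :=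
      hint.lintegral_lt_top.ne
    rw [hI, hlint]
    refine ENNReal.toReal_mono hfin ?_
    rw [lintegral_prod_symm _ hφm.ennreal_ofReal.aemeasurable]
    refine lintegral_mono fun v => ?_
    rw [hμ, ← lintegral_indicator (measurableSet_cube z R)]
    refine lintegral_mono fun x => ?_
    by_cases hx : x ∈ cube z R
    · rw [Set.indicator_of_mem hx, hφ, ENNReal.ofReal_prod_of_nonneg fun s _ => hf0 s _]
      refine Finset.prod_le_prod' fun s _ => ?_
      by_cases hy : x + (∑ i, if s i then v i else 0) ∈ A ∩ cube z R
      · rcases hf s with h | h <;> simp [h, Set.indicator_of_mem hy, Set.indicator_of_mem hy.1]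
      · simp [Set.indicator_of_notMem hy]
    · refine (Finset.prod_eq_zero (Finset.mem_univ fun _ => false) ?_).trans_le zero_le
      simp [hx]

lemma jointAvg_bounds (n : ℕ) {A : Set Plane} (hA : MeasurableSet A)
    {f : (Fin n → Bool) → Plane → ℝ} (hf : ∀ s, f s = A.indicator 1 ∨ f s = fun _ => 1)
    (z : Plane) {R r : ℝ} (hr : 0 < r) (hrR : r ≤ R) :
    0 ≤ jointAvg n f z R r ∧ jointAvg n f z R r ≤ 1 ∧
      (1 / 16) ^ 2 ^ n * ((volume (A ∩ cube z R)).toReal / R ^ 2) ^ 2 ^ n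
        ≤ jointAvg n f z R r := by
  have hR : 0 < R := hr.trans_le hrR
  obtain ⟨h0, h1, hmass⟩ := integral_vertices_bounds n hA hf z hr.le hR.le
  have heq : jointAvg n f z R r =
      (∫ x in cube z R, ∫ v in {v : Fin n → Plane | ∀ i j, |v i j| ≤ r},
        ∏ s : Fin n → Bool, f s (x + ∑ i, if s i then v i else 0)) /
        (((2 * r) ^ 2) ^ n * R ^ 2) := by
    have h2r : (2 * r) ^ (-(2 * (n : ℝ))) = (((2 * r) ^ 2) ^ n)⁻¹ := by
      rw [Real.rpow_neg (by positivity), ← pow_mul, ← Real.rpow_natCast]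
      push_cast
      rfl
    have hR2 : R ^ (-2 : ℝ) = (R ^ 2)⁻¹ := by
      rw [Real.rpow_neg hR.le, Real.rpow_two]
    rw [jointAvg, h2r, hR2, ← mul_inv, div_eq_inv_mul]
  have hden : 0 < ((2 * r) ^ 2) ^ n * R ^ 2 := by positivity
  rw [heq]
  refine ⟨by positivity, (div_le_one hden).2 h1, ?_⟩
  have hB : MeasurableSet (A ∩ cube z R) := hA.inter (measurableSet_cube z R)
  have hpow := pow_le_parallelepipedMass n (g := (A ∩ cube z R).indicator 1)
    (measurable_one.indicator hB) (z := z) hr hrR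
    (fun x hx => Set.indicator_of_notMem (fun h => hx h.2) _)
    (fun x => Set.indicator_le' (fun _ _ => le_rfl) (fun _ _ => zero_le_one) x)
  rw [lintegral_indicator_one hB] at hpow
  calc _ = ((volume (A ∩ cube z R)).toReal / R ^ 2 / 16) ^ 2 ^ n := by
        rw [← mul_pow]
        ring
    _ ≤ _ := hpow
    _ ≤ (parallelepipedMass n ((A ∩ cube z R).indicator 1) r).toReal /
          (((2 * r) ^ 2) ^ n * R ^ 2) := div_le_self (by positivity) (by norm_num)
    _ ≤ _ := by gcongr

/-- The infimum over scales of a joint average lies in `[0,1]`. -/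
lemma iInf_jointAvg_mem_Icc (n : ℕ) {A : Set Plane} (hA : MeasurableSet A)
    {f : (Fin n → Bool) → Plane → ℝ} (hf : ∀ s, f s = A.indicator 1 ∨ f s = fun _ => 1)
    (z : Plane) {M : ℝ} (hM : 1 ≤ M) (R : ℝ) :
    (⨅ r : {r : ℝ // M ≤ r ∧ r ≤ R / 2 ^ n}, jointAvg n f z R r) ∈ Set.Icc (0 : ℝ) 1 := by
  have h (r : {r : ℝ // M ≤ r ∧ r ≤ R / 2 ^ n}) :
      0 ≤ jointAvg n f z R r ∧ jointAvg n f z R r ≤ 1 := by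
    have hr : (0 : ℝ) < r := by linarith [r.2.1]
    have hrR : (r : ℝ) ≤ R := by
      have := (le_div_iff₀ (by positivity)).1 r.2.2
      nlinarith [one_le_pow₀ (M₀ := ℝ) one_le_two (n := n)]
    obtain ⟨h0, h1, -⟩ := jointAvg_bounds n hA hf z hr hrR
    exact ⟨h0, h1⟩
  refine ⟨Real.iInf_nonneg fun r => (h r).1, ?_⟩
  rcases isEmpty_or_nonempty {r : ℝ // M ≤ r ∧ r ≤ R / 2 ^ n} with he | ⟨⟨r⟩⟩
  · rw [Real.iInf_of_isEmpty]
    exact zero_le_one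
  · exact (ciInf_le ⟨0, Set.forall_mem_range.2 fun r => (h r).1⟩ r).trans (h r).2

theorem jointDensity_lower_bound (n : ℕ) :
    ∃ c : ℝ, 0 < c ∧
      ∀ A : Set (EuclideanSpace ℝ (Fin 2)), MeasurableSet A →
        ∀ f : (Fin n → Bool) → EuclideanSpace ℝ (Fin 2) → ℝ,
          (∀ s, f s = A.indicator 1 ∨ f s = fun _ => 1) →
          c * banachDensity A ^ (2 ^ n : ℕ) ≤ jointDensity n f := by
  refine ⟨(1 / 16) ^ 2 ^ n, by positivity, fun A hA f hf => ?_⟩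
  set G : ℝ → ℝ → ℝ := fun M R =>
    ⨆ z : Plane, ⨅ r : {r : ℝ // M ≤ r ∧ r ≤ R / 2 ^ n}, jointAvg n f z R r with hG
  have hbdd {M : ℝ} (hM : 1 ≤ M) (R : ℝ) : BddAbove (Set.range fun z : Plane =>
      ⨅ r : {r : ℝ // M ≤ r ∧ r ≤ R / 2 ^ n}, jointAvg n f z R r) :=
    ⟨1, Set.forall_mem_range.2 fun z => (iInf_jointAvg_mem_Icc n hA hf z hM R).2⟩
  have hG0 {M : ℝ} (hM : 1 ≤ M) (R : ℝ) : 0 ≤ G M R :=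
    Real.iSup_nonneg fun z => (iInf_jointAvg_mem_Icc n hA hf z hM R).1
  have hG1 {M : ℝ} (hM : 1 ≤ M) (R : ℝ) : G M R ≤ 1 :=
    ciSup_le fun z => (iInf_jointAvg_mem_Icc n hA hf z hM R).2
  have hlim1 {M : ℝ} (hM : 1 ≤ M) : Filter.limsup (G M) Filter.atTop ≤ 1 :=
    Filter.limsup_le_of_le
      (Filter.isCoboundedUnder_le_of_le _ fun R => hG0 hM R)
      (Filter.Eventually.of_forall fun R => hG1 hM R)
  have hjd : Filter.limsup (G 1) Filter.atTop ≤ jointDensity n f := by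
    refine le_ciSup_of_le ⟨1, Set.forall_mem_range.2 fun M => ?_⟩ 1 ?_
    · exact Real.iSup_le (fun hM => hlim1 hM) zero_le_one
    · exact le_ciSup_of_le ⟨1, Set.forall_mem_range.2 fun hM => hlim1 hM⟩ le_rfl le_rfl
  refine le_trans ?_ hjd
  set D : ℝ → ℝ := fun R => ⨆ z : Plane, (volume (A ∩ cube z R)).toReal / R ^ 2 with hD
  have hD0 (R : ℝ) : 0 ≤ D R := Real.iSup_nonneg fun z => by positivity
  have hδ0 : 0 ≤ banachDensity A := by
    rw [banachDensity, Filter.limsup_eq]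
    refine Real.sInf_nonneg fun a ha => ?_
    obtain ⟨R, hR⟩ := Filter.Eventually.exists (f := Filter.atTop) ha
    exact (hD0 R).trans hR
  have hlt (t : ℝ) (ht : t < banachDensity A) :
      (1 / 16) ^ 2 ^ n * max t 0 ^ 2 ^ n ≤ Filter.limsup (G 1) Filter.atTop := by
    have hfreq : ∃ᶠ R in Filter.atTop, t < D R :=
      Filter.frequently_lt_of_lt_limsup
        (Filter.isCoboundedUnder_le_of_le _ hD0) ht
    refine Filter.le_limsup_of_frequently_le ?_
      (Filter.isBoundedUnder_of ⟨1, fun R => hG1 le_rfl R⟩)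
    refine (hfreq.and_eventually (Filter.eventually_ge_atTop (2 ^ n))).mono fun R hR => ?_
    obtain ⟨htD, hR⟩ := hR
    obtain ⟨z, hz⟩ := exists_lt_of_lt_ciSup htD
    refine le_ciSup_of_le (hbdd le_rfl R) z ?_
    have : Nonempty {r : ℝ // 1 ≤ r ∧ r ≤ R / 2 ^ n} :=
      ⟨⟨1, le_rfl, (one_le_div (by positivity)).2 hR⟩⟩
    refine le_ciInf fun r => ?_
    have hr : (0 : ℝ) < r := by linarith [r.2.1]
    have hrR : (r : ℝ) ≤ R := by
      have := (le_div_iff₀ (by positivity)).1 r.2.2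
      nlinarith [one_le_pow₀ (M₀ := ℝ) one_le_two (n := n)]
    refine le_trans ?_ (jointAvg_bounds n hA hf z hr hrR).2.2
    gcongr
    exact max_le hz.le (by positivity)
  have hcont : Continuous fun t : ℝ => (1 / 16 : ℝ) ^ 2 ^ n * max t 0 ^ 2 ^ n := by fun_prop
  have h := le_of_tendsto
    (hcont.continuousWithinAt (s := Set.Iio (banachDensity A)) (x := banachDensity A))
    (eventually_mem_nhdsWithin.mono hlt)
  simpa only [max_eq_left hδ0] using h
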